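/- Let A ∈ ℤ^{d×n} be a unimodular matrix of rank d. Then the normality condition holds for the centrally symmetric configuration A^±: ℤ_{≥0}A^± = ℤA^± ∩ ℚ_{≥0}A^±, i.e. the toric ring K[A^±] is normal. -/

import Mathlib

/-- The subgroup `ℤA` of `ℤ^d` generated by the columns of an integer matrix. -/
def colLattice {d n : ℕ} (A : Matrix (Fin d) (Fin n) ℤ) : AddSubgroup (Fin d → ℤ) :=
  AddSubgroup.closure (Set.range fun j i => A i j)

/-- The submonoid `ℤ_{≥0}A` of `ℤ^d` generated by the columns of an integer matrix. -/
def colMonoid {d n : ℕ} (A : Matrix (Fin d) (Fin n) ℤ) : AddSubmonoid (Fin d → ℤ) :=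
  AddSubmonoid.closure (Set.range fun j i => A i j)

/-- The set `ℚ_{≥0}A` of lattice points that are nonnegative rational combinations of
the columns of `A`. -/
def colQNonneg {d n : ℕ} (A : Matrix (Fin d) (Fin n) ℤ) : Set (Fin d → ℤ) :=
  {x | ∃ r : Fin n → ℚ, (∀ j, 0 ≤ r j) ∧ ∀ i, (x i : ℚ) = ∑ j, r j * (A i j : ℚ)}

/-- The normality condition `ℤ_{≥0}A = ℤA ∩ ℚ_{≥0}A` for the toric ring `K[A]`. -/
def IsNormalConfig {d n : ℕ} (A : Matrix (Fin d) (Fin n) ℤ) : Prop :=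
  (colMonoid A : Set (Fin d → ℤ)) = (colLattice A : Set (Fin d → ℤ)) ∩ colQNonneg A

/-- The centrally symmetric configuration `A^± ∈ ℤ^{(d+1)×(2n+1)}` of `A ∈ ℤ^{d×n}`:
its columns are `(0,…,0,1)ᵀ` (column `0`), `(a_j, 1)ᵀ` (columns `1,…,n`) and
`(−a_j, 1)ᵀ` (columns `n+1,…,2n`). -/
def csc {d n : ℕ} (A : Matrix (Fin d) (Fin n) ℤ) :
    Matrix (Fin (d + 1)) (Fin (2 * n + 1)) ℤ := fun i j =>
  if hi : (i : ℕ) < d then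
    if h0 : (j : ℕ) = 0 then 0
    else if hj : (j : ℕ) ≤ n then A ⟨i, hi⟩ ⟨(j : ℕ) - 1, by omega⟩
    else - A ⟨i, hi⟩ ⟨(j : ℕ) - n - 1, by have := j.isLt; omega⟩
  else 1

open Matrix in
/-- The columns of an integer matrix of full row rank span `ℚ^d`. -/
theorem span_ratCols_eq_top {d n : ℕ} (A : Matrix (Fin d) (Fin n) ℤ) (hrank : A.rank = d) :
    Submodule.span ℚ (Set.range fun j i => (A i j : ℚ)) = ⊤ := by
  rw [rank_eq_finrank_span_cols] at hrank
  obtain ⟨f, hf⟩ := exists_linearIndependent_of_le_finrank hrank.ge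
  have hf' : LinearIndependent ℤ fun k => (f k : Fin d → ℤ) :=
    hf.map' (Submodule.subtype _) (Submodule.ker_subtype _)
  have hfQ := (linearIndependent_algebraMap_comp_iff (S := ℚ)).2 hf'
  rw [eq_top_iff, ← hfQ.span_eq_top_of_card_eq_finrank' (by simp), Submodule.span_le]
  rintro _ ⟨k, rfl⟩
  have key : ∀ x ∈ Submodule.span ℤ (Set.range A.col),
      (fun i => (x i : ℚ)) ∈ Submodule.span ℚ (Set.range fun j i => (A i j : ℚ)) := by
    intro x hx
    induction hx using Submodule.span_induction with
    | mem x hx =>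
      obtain ⟨j, rfl⟩ := hx
      exact Submodule.subset_span ⟨j, rfl⟩
    | zero => convert Submodule.zero_mem _ using 1; ext; simp
    | add x y _ _ hx hy => convert Submodule.add_mem _ hx hy using 1; ext; simp
    | smul a x _ hx => convert Submodule.smul_mem _ (a : ℚ) hx using 1; ext; simp
  exact key _ (f k).2

/-- Reduction of a nontrivial dependency: a linear combination with dependent support can be
rewritten with smaller support without increasing the `ℓ¹`-norm of the coefficients. -/
theorem exists_support_ssubset_of_not_linearIndepOn {ι K M : Type*} [Fintype ι] [Field K]
    [LinearOrder K] [IsStrictOrderedRing K] [AddCommGroup M] [Module K M] (v : ι → M) (r : ι → K)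
    (h : ¬ LinearIndepOn K v (Function.support r)) :
    ∃ r' : ι → K, ∑ j, r' j • v j = ∑ j, r j • v j ∧ ∑ j, |r' j| ≤ ∑ j, |r j| ∧
      Function.support r' ⊂ Function.support r := by
  classical
  obtain ⟨l, hl0, hlv, hls⟩ : ∃ l : ι → K, l ≠ 0 ∧ ∑ j, l j • v j = 0 ∧
      ∀ j, r j = 0 → l j = 0 := by
    simp only [linearIndepOn_iff, not_forall] at h
    obtain ⟨l, hl, hlv, hl0⟩ := h
    refine ⟨l, by simpa using hl0, ?_, fun j hj => ?_⟩
    · rwa [Finsupp.linearCombination_apply, Finsupp.sum_fintype _ _ (by simp)] at hlv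
    · by_contra hne
      exact (Finsupp.mem_supported _ _).1 hl (Finsupp.mem_support_iff.2 hne) hj
  set s : ι → K := fun j => SignType.sign (r j) with hs
  obtain ⟨l, hl0, hlv, hls, hsum⟩ : ∃ l : ι → K, l ≠ 0 ∧ ∑ j, l j • v j = 0 ∧
      (∀ j, r j = 0 → l j = 0) ∧ 0 ≤ ∑ j, s j * l j := by
    rcases le_total 0 (∑ j, s j * l j) with h0 | h0
    · exact ⟨l, hl0, hlv, hls, h0⟩
    · exact ⟨-l, by simpa using hl0, by simpa using hlv, by simpa using hls, by simpa using h0⟩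
  obtain ⟨k, hk⟩ : ∃ k, 0 < s k * l k := by
    by_contra! hcon
    have hz := (Finset.sum_eq_zero_iff_of_nonpos fun j _ => hcon j).1
      (le_antisymm (Finset.sum_nonpos fun j _ => hcon j) hsum)
    refine hl0 (funext fun j => ?_)
    rcases mul_eq_zero.1 (hz j (Finset.mem_univ j)) with hj | hj
    · refine hls j (by_contra fun hr => ?_)
      rcases lt_or_gt_of_ne hr with hr | hr
      · simp [hs, sign_neg hr] at hj
      · simp [hs, sign_pos hr] at hj
    · exact hj
  obtain ⟨m, hm, hmin⟩ := Finset.exists_min_image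
    (Finset.univ.filter fun j => 0 < s j * l j) (fun j => |r j| / (s j * l j)) ⟨k, by simpa using hk⟩
  simp only [Finset.mem_filter, Finset.mem_univ, true_and] at hm hmin
  set t := |r m| / (s m * l m) with ht
  have ht0 : 0 ≤ t := div_nonneg (abs_nonneg _) hm.le
  have hle : ∀ j, t * (s j * l j) ≤ |r j| := by
    intro j
    rcases lt_or_ge 0 (s j * l j) with hj | hj
    · exact (le_div_iff₀ hj).1 (hmin j hj)
    · exact (mul_nonpos_of_nonneg_of_nonpos ht0 hj).trans (abs_nonneg _)
  have habs : ∀ j, |r j - t * l j| = |r j| - t * (s j * l j) := by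
    intro j
    have hj := hle j
    rcases lt_trichotomy (r j) 0 with h0 | h0 | h0
    · simp only [hs, sign_neg h0, abs_of_neg h0, SignType.coe_neg,
        SignType.coe_one] at hj ⊢
      rw [abs_of_nonpos (by linarith)]
      ring
    · simp [h0, hls j h0]
    · simp only [hs, sign_pos h0, abs_of_pos h0, SignType.coe_one] at hj ⊢
      rw [abs_of_nonneg (by linarith)]
      ring
  refine ⟨fun j => r j - t * l j, ?_, ?_, ?_⟩
  · simp [sub_smul, mul_smul, Finset.sum_sub_distrib, ← Finset.smul_sum, hlv]
  · simp only [habs, Finset.sum_sub_distrib, ← Finset.mul_sum]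
    linarith [mul_nonneg ht0 hsum]
  · refine Set.ssubset_iff_exists.2 ⟨fun j hj h0 => hj ?_, m, fun h0 => ?_, ?_⟩
    · simp [h0, hls j h0]
    · simp [hs, h0] at hm
    · have : |r m - t * l m| = 0 := by
        rw [habs, ht, div_mul_cancel₀ _ hm.ne', sub_self]
      simpa using this

/-- Every linear combination can be rewritten with linearly independent support without
increasing the `ℓ¹`-norm of the coefficients. -/
theorem exists_linearIndepOn_support {ι K M : Type*} [Fintype ι] [Field K]
    [LinearOrder K] [IsStrictOrderedRing K] [AddCommGroup M] [Module K M] (v : ι → M) (r : ι → K) :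
    ∃ r' : ι → K, ∑ j, r' j • v j = ∑ j, r j • v j ∧ ∑ j, |r' j| ≤ ∑ j, |r j| ∧
      LinearIndepOn K v (Function.support r') := by
  by_cases h : LinearIndepOn K v (Function.support r)
  · exact ⟨r, rfl, le_rfl, h⟩
  · obtain ⟨r₁, h₁, h₂, h₃⟩ := exists_support_ssubset_of_not_linearIndepOn v r h
    have := Set.ncard_lt_ncard h₃
    obtain ⟨r₂, h₄, h₅, h₆⟩ := exists_linearIndepOn_support v r₁
    exact ⟨r₂, h₄.trans h₁, h₅.trans h₂, h₆⟩
termination_by (Function.support r).ncard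

/-- A linearly independent set of columns of a full row rank integer matrix extends to the columns
of a nonzero maximal minor. -/
theorem exists_det_submatrix_ne_zero {d n : ℕ} (A : Matrix (Fin d) (Fin n) ℤ) (hrank : A.rank = d)
    {s : Set (Fin n)} (hs : LinearIndepOn ℚ (fun j i => (A i j : ℚ)) s) :
    ∃ σ : Fin d → Fin n, s ⊆ Set.range σ ∧ (A.submatrix id σ).det ≠ 0 := by
  classical
  obtain ⟨b, -, hsb, hspan, hb⟩ := exists_linearIndepOn_extension hs (Set.subset_univ s)
  have htop : Submodule.span ℚ ((fun j i => (A i j : ℚ)) '' b) = ⊤ := by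
    rw [eq_top_iff, ← span_ratCols_eq_top A hrank, Submodule.span_le, ← Set.image_univ]
    exact hspan
  have hcard : Fintype.card b = d := by
    have hB := Module.finrank_eq_card_basis (Module.Basis.mk hb (by
      rw [← htop, Set.image_eq_range]))
    simpa using hB.symm
  let e : Fin d ≃ b := (finCongr hcard.symm).trans (Fintype.equivFin b).symm
  refine ⟨fun k => e k, fun j hj => ⟨e.symm ⟨j, hsb hj⟩, by simp⟩, ?_⟩
  have hli := LinearIndependent.comp hb e e.injective
  have hu : IsUnit ((A.submatrix id fun k => (e k : Fin n)).map (Int.castRingHom ℚ)) :=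
    Matrix.linearIndependent_cols_iff_isUnit.1 hli
  rw [Matrix.isUnit_iff_isUnit_det, ← RingHom.mapMatrix_apply, ← RingHom.map_det] at hu
  intro h0
  simp [h0] at hu

/-- For a unimodular matrix, the columns of a nonzero maximal minor generate all columns. -/
theorem exists_mulVec_eq_col {d n : ℕ} (A : Matrix (Fin d) (Fin n) ℤ)
    (hA : ∀ σ τ : Fin d → Fin n,
      (A.submatrix id σ).det ≠ 0 → (A.submatrix id τ).det ≠ 0 →
        (A.submatrix id σ).det.natAbs = (A.submatrix id τ).det.natAbs)
    {σ : Fin d → Fin n} (hσ : (A.submatrix id σ).det ≠ 0) (j : Fin n) :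
    ∃ w : Fin d → ℤ, (A.submatrix id σ).mulVec w = A.col j := by
  have hdvd : ∀ k, (A.submatrix id σ).det ∣ (A.submatrix id σ).cramer (A.col j) k := by
    intro k
    have hup : (A.submatrix id σ).updateCol k (A.col j) =
        A.submatrix id (Function.update σ k j) := by
      ext i l
      by_cases hl : l = k
      · subst hl; simp
      · simp [hl]
    rw [Matrix.cramer_apply, hup]
    by_cases h0 : (A.submatrix id (Function.update σ k j)).det = 0
    · simp [h0]
    · exact Int.natAbs_dvd_natAbs.1 (hA _ _ hσ h0).dvd
  choose w hw using hdvd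
  refine ⟨w, ?_⟩
  have h := Matrix.mulVec_cramer (A.submatrix id σ) (A.col j)
  rw [show (A.submatrix id σ).cramer (A.col j) = (A.submatrix id σ).det • w from funext hw,
    Matrix.mulVec_smul] at h
  exact smul_right_injective _ hσ h

/-- For a unimodular matrix, a rational representation of a vector of the column lattice can be
replaced by an integral one without increasing the `ℓ¹`-norm of the coefficients. -/
theorem exists_int_combination_of_unimodular {d n : ℕ}
    (A : Matrix (Fin d) (Fin n) ℤ) (hrank : A.rank = d)
    (hA : ∀ σ τ : Fin d → Fin n,
      (A.submatrix id σ).det ≠ 0 → (A.submatrix id τ).det ≠ 0 →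
        (A.submatrix id σ).det.natAbs = (A.submatrix id τ).det.natAbs)
    (z : Fin n → ℤ) (c : Fin n → ℚ)
    (hzc : ∀ i, ((∑ j, z j * A i j : ℤ) : ℚ) = ∑ j, c j * (A i j : ℚ)) :
    ∃ e : Fin n → ℤ, (∀ i, ∑ j, e j * A i j = ∑ j, z j * A i j) ∧
      ((∑ j, |e j| : ℤ) : ℚ) ≤ ∑ j, |c j| := by
  obtain ⟨r, hr, hle, hli⟩ := exists_linearIndepOn_support (fun j i => (A i j : ℚ)) c
  replace hr : ∀ i, ∑ j, r j * (A i j : ℚ) = ∑ j, c j * (A i j : ℚ) := fun i => by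
    simpa using congrFun hr i
  obtain ⟨σ, hsub, hσ⟩ := exists_det_submatrix_ne_zero A hrank hli
  choose w hw using exists_mulVec_eq_col A hA hσ
  set B := A.submatrix id σ with hB
  have hinj : Function.Injective σ := by
    intro a b hab
    by_contra hne
    exact hσ (Matrix.det_zero_of_column_eq hne fun i => by simp [hB, hab])
  have hBz : B.mulVec (∑ j, z j • w j) = fun i => ∑ j, z j * A i j := by
    ext i
    rw [Matrix.mulVec_sum, Finset.sum_apply]
    simp_rw [Matrix.mulVec_smul, hw]
    simp
  have hrB : ∀ i, ∑ j, r j * (A i j : ℚ) = ∑ k, r (σ k) * (B i k : ℚ) := by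
    intro i
    refine (Fintype.sum_of_injective σ hinj _ _ (fun j hj => ?_) fun k => rfl).symm
    rw [Function.notMem_support.1 fun h => hj (hsub h), zero_mul]
  have hdet : (B.map (Int.castRingHom ℚ)).det ≠ 0 := by
    rw [← RingHom.mapMatrix_apply, ← RingHom.map_det]
    simpa using hσ
  have hv : (fun k => r (σ k) - (((∑ j, z j • w j) k : ℤ) : ℚ)) = 0 := by
    refine Matrix.eq_zero_of_mulVec_eq_zero hdet (funext fun i => ?_)
    have h1 := congrArg (Int.cast : ℤ → ℚ) (congrFun hBz i)
    rw [hzc, ← hr, hrB] at h1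
    simp only [Matrix.mulVec, dotProduct, Int.cast_sum, Int.cast_mul] at h1
    simp only [Matrix.mulVec, dotProduct, Matrix.map_apply, mul_sub, Finset.sum_sub_distrib,
      Pi.zero_apply, Int.coe_castRingHom, h1]
    rw [sub_eq_zero]
    exact Finset.sum_congr rfl fun k _ => mul_comm _ _
  have hint : ∀ j, ∃ e : ℤ, (e : ℚ) = r j := by
    intro j
    by_cases hj : r j = 0
    · exact ⟨0, by simp [hj]⟩
    · obtain ⟨k, rfl⟩ := hsub hj
      exact ⟨_, (sub_eq_zero.1 (congrFun hv k)).symm⟩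
  choose e he using hint
  refine ⟨e, fun i => ?_, ?_⟩
  · have : ((∑ j, e j * A i j : ℤ) : ℚ) = ((∑ j, z j * A i j : ℤ) : ℚ) := by
      rw [hzc, ← hr]
      simp [he]
    exact_mod_cast this
  · simpa [he] using hle

/-- Sums over the column indices of `csc A`, split into the three blocks of columns. -/
theorem sum_fin_two_mul_add_one {M : Type*} [AddCommMonoid M] {n : ℕ} (f : Fin (2 * n + 1) → M) :
    ∑ j, f j = f 0 + (∑ j : Fin n, f ⟨j + 1, by omega⟩ +
      ∑ j : Fin n, f ⟨n + j + 1, by omega⟩) := by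
  rw [Fin.sum_univ_succ, ← Fin.sum_congr' _ (two_mul n).symm, Fin.sum_univ_add]
  rfl

theorem csc_castSucc_zero {d n : ℕ} (A : Matrix (Fin d) (Fin n) ℤ) (i : Fin d) :
    csc A i.castSucc 0 = 0 := by
  simp [csc]

theorem csc_castSucc_pos {d n : ℕ} (A : Matrix (Fin d) (Fin n) ℤ) (i : Fin d) (j : Fin n) :
    csc A i.castSucc ⟨j + 1, by omega⟩ = A i j := by
  simp [csc]

theorem csc_castSucc_neg {d n : ℕ} (A : Matrix (Fin d) (Fin n) ℤ) (i : Fin d) (j : Fin n) :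
    csc A i.castSucc ⟨n + j + 1, by omega⟩ = -A i j := by
  have h : ¬ n + (j : ℕ) + 1 ≤ n := by omega
  have h' : n + (j : ℕ) + 1 - n - 1 = j := by omega
  simp [csc, h, h']

theorem csc_last {d n : ℕ} (A : Matrix (Fin d) (Fin n) ℤ) (j : Fin (2 * n + 1)) :
    csc A (Fin.last d) j = 1 := by
  simp [csc]

theorem mem_colLattice_iff {d n : ℕ} (A : Matrix (Fin d) (Fin n) ℤ) (x : Fin d → ℤ) :
    x ∈ colLattice A ↔ ∃ z : Fin n → ℤ, ∀ i, x i = ∑ j, z j * A i j := by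
  rw [colLattice, ← Submodule.span_int_eq_addSubgroupClosure, Submodule.mem_toAddSubgroup,
    Submodule.mem_span_range_iff_exists_fun]
  simp [funext_iff, eq_comm]

theorem colMonoid_subset_colQNonneg {d n : ℕ} (A : Matrix (Fin d) (Fin n) ℤ) :
    (colMonoid A : Set (Fin d → ℤ)) ⊆ colQNonneg A := by
  intro x hx
  induction hx using AddSubmonoid.closure_induction with
  | mem x hx =>
    obtain ⟨j, rfl⟩ := hx
    refine ⟨Pi.single j 1, fun k => ?_, fun i => ?_⟩
    · by_cases h : k = j
      · subst h; simp
      · simp [h]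
    · simp [Pi.single_apply]
  | zero => exact ⟨0, by simp, by simp⟩
  | add x y _ _ hx hy =>
    obtain ⟨r, hr, hx⟩ := hx
    obtain ⟨s, hs, hy⟩ := hy
    exact ⟨r + s, fun j => add_nonneg (hr j) (hs j), fun i => by
      simp [hx, hy, add_mul, Finset.sum_add_distrib]⟩

theorem colMonoid_subset_colLattice {d n : ℕ} (A : Matrix (Fin d) (Fin n) ℤ) :
    (colMonoid A : Set (Fin d → ℤ)) ⊆ colLattice A :=
  AddSubmonoid.closure_le (S := (colLattice A).toAddSubmonoid) |>.2 AddSubgroup.subset_closure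

/-- **Corollary 2.7.** If `A ∈ ℤ^{d×n}` is a unimodular matrix of rank `d`
(all nonzero maximal minors have the same absolute value), then the normality
condition `ℤ_{≥0}A^± = ℤA^± ∩ ℚ_{≥0}A^±` holds for the centrally symmetric
configuration `A^±`; i.e. the toric ring `K[A^±]` is normal. -/
theorem csc_normal_of_unimodular (d n : ℕ)
    (A : Matrix (Fin d) (Fin n) ℤ) (hrank : A.rank = d)
    (hA : ∀ σ τ : Fin d → Fin n,
      (A.submatrix id σ).det ≠ 0 → (A.submatrix id τ).det ≠ 0 →
        (A.submatrix id σ).det.natAbs = (A.submatrix id τ).det.natAbs) :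
    IsNormalConfig (csc A) := by
  refine Set.Subset.antisymm
    (Set.subset_inter (colMonoid_subset_colLattice _) (colMonoid_subset_colQNonneg _)) ?_
  rintro x ⟨hx, r, hr0, hr⟩
  obtain ⟨z, hz⟩ := (mem_colLattice_iff _ _).1 hx
  have hz' : ∀ i : Fin d, x i.castSucc =
      ∑ j : Fin n, (z ⟨j + 1, by omega⟩ - z ⟨n + j + 1, by omega⟩) * A i j := by
    intro i
    rw [hz, sum_fin_two_mul_add_one, ← Finset.sum_add_distrib]
    simp only [csc_castSucc_zero, csc_castSucc_pos, csc_castSucc_neg, mul_zero, zero_add]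
    exact Finset.sum_congr rfl fun j _ => by ring
  have hr' : ∀ i : Fin d, (x i.castSucc : ℚ) =
      ∑ j : Fin n, (r ⟨j + 1, by omega⟩ - r ⟨n + j + 1, by omega⟩) * (A i j : ℚ) := by
    intro i
    rw [hr, sum_fin_two_mul_add_one, ← Finset.sum_add_distrib]
    simp only [csc_castSucc_zero, csc_castSucc_pos, csc_castSucc_neg, Int.cast_zero, Int.cast_neg,
      mul_zero, zero_add]
    exact Finset.sum_congr rfl fun j _ => by ring
  obtain ⟨e, he, hle⟩ := exists_int_combination_of_unimodular A hrank hA _ _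
    fun i => (congrArg Int.cast (hz' i)).symm.trans (hr' i)
  have hlast : ∑ j, |e j| ≤ x (Fin.last d) := by
    have hsum : ∑ j : Fin n, |r ⟨j + 1, by omega⟩ - r ⟨n + j + 1, by omega⟩| ≤
        (x (Fin.last d) : ℚ) := by
      rw [hr, sum_fin_two_mul_add_one, ← Finset.sum_add_distrib]
      simp only [csc_last, Int.cast_one, mul_one]
      refine (Finset.sum_le_sum fun j _ => ?_).trans (le_add_of_nonneg_left (hr0 0))
      refine (abs_sub _ _).trans ?_
      rw [abs_of_nonneg (hr0 _), abs_of_nonneg (hr0 _)]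
    exact_mod_cast hle.trans hsum
  have hcol : ∀ j, (fun i => csc A i j) ∈ colMonoid (csc A) := fun j =>
    AddSubmonoid.subset_closure ⟨j, rfl⟩
  have hx_eq : x = (x (Fin.last d) - ∑ j, |e j|).toNat • (fun i => csc A i 0) +
      ∑ j : Fin n, ((e j).toNat • (fun i => csc A i ⟨j + 1, by omega⟩) +
        (-e j).toNat • (fun i => csc A i ⟨n + j + 1, by omega⟩)) := by
    ext i
    refine Fin.lastCases ?_ (fun i => ?_) i
    · simp only [Pi.add_apply, Pi.smul_apply, Finset.sum_apply, csc_last]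
      simp only [nsmul_eq_mul, mul_one, Int.toNat_of_nonneg (sub_nonneg.2 hlast)]
      rw [sub_add_eq_add_sub, eq_sub_iff_add_eq, add_right_inj]
      exact Finset.sum_congr rfl fun j _ => by grind
    · simp only [Pi.add_apply, Pi.smul_apply, Finset.sum_apply, csc_castSucc_zero,
        csc_castSucc_pos, csc_castSucc_neg]
      simp only [nsmul_eq_mul, mul_zero, zero_add]
      rw [hz', ← he]
      refine Finset.sum_congr rfl fun j _ => ?_
      rw [mul_neg, ← sub_eq_add_neg, ← sub_mul]
      congr 1
      omega
  rw [hx_eq]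
  exact add_mem (nsmul_mem (hcol _) _) (sum_mem fun j _ =>
    add_mem (nsmul_mem (hcol _) _) (nsmul_mem (hcol _) _))
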